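/- arXiv:2410.09225 — 3 statements merged into one kernel-verified Lean document; each statement's English description precedes it below -/
import Mathlib

section
/- Let a > 0, b > 0 and let f : ℝ → ℝ be a feasible platform influence function. Suppose there exist z ∈ (0, 1] and y ∈ [−1, 0) such that f(z) ≥ G(z, y, a, b) and f(y) ≤ H(z, y, a, b). Then there exists x* ∈ (0, 1] with f(x*) = (2a/b + 1)·x*, and consequently the point (x*, −x*), with x* > 0 > −x*, is an equilibrium of the two-agent opinion dynamics, i.e. a persistent disagreement state. -/
/-- Polarization plane `G(z, y, a, b) = a·(z − y)/b + z`. -/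
noncomputable def polG (z y a b : ℝ) : ℝ := a * (z - y) / b + z

/-- Polarization plane `H(z, y, a, b) = a·(y − z)/b + y`. -/
noncomputable def polH (z y a b : ℝ) : ℝ := a * (y - z) / b + y

/-- A point `(p, q) ∈ [−1,1]²` is an equilibrium of the two-agent opinion
dynamics for `(a, b, f)`. -/
def IsTwoAgentEquilibrium (a b : ℝ) (f : ℝ → ℝ) (p q : ℝ) : Prop :=
  p ∈ Set.Icc (-1 : ℝ) 1 ∧ q ∈ Set.Icc (-1 : ℝ) 1 ∧
  a * (q - p) + b * (f p - p) = 0 ∧ a * (p - q) + b * (f q - q) = 0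

/-- A feasible platform influence function: continuous, odd, sign-preserving,
and bounded by 1 on `[−1,1]`. -/
def IsFeasiblePlatformFunction (f : ℝ → ℝ) : Prop :=
  Continuous f ∧
  (∀ x : ℝ, f (-x) = -f x) ∧
  (∀ x : ℝ, 0 < x → 0 < f x) ∧
  (∀ x : ℝ, x < 0 → f x < 0) ∧
  (∀ x ∈ Set.Icc (-1 : ℝ) 1, |f x| ≤ 1)

/-- A continuous function bounded by `1` at `1` and lying above the line of slope `k ≥ 1` at some
point of `(0, 1]` meets that line on `(0, 1]`. -/
theorem exists_eq_mul_of_mul_le {f : ℝ → ℝ} {k m : ℝ} (hf : Continuous f) (h1 : f 1 ≤ 1)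
    (hk : 1 ≤ k) (hm : m ∈ Set.Ioc (0 : ℝ) 1) (hfm : k * m ≤ f m) :
    ∃ x ∈ Set.Ioc (0 : ℝ) 1, f x = k * x := by
  have hcont : ContinuousOn (fun x => f x - k * x) (Set.Icc m 1) := by fun_prop
  obtain ⟨x, hx, hx0⟩ := intermediate_value_Icc' hm.2 hcont
    (show (0 : ℝ) ∈ Set.Icc _ _ from ⟨by linarith, by linarith⟩)
  exact ⟨x, ⟨hm.1.trans_le hx.1, hx.2⟩, sub_eq_zero.mp hx0⟩

theorem stmt2 (a b : ℝ) (ha : 0 < a) (hb : 0 < b) (f : ℝ → ℝ)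
    (hf : IsFeasiblePlatformFunction f)
    (hexists : ∃ z ∈ Set.Ioc (0 : ℝ) 1, ∃ y ∈ Set.Ico (-1 : ℝ) 0,
      polG z y a b ≤ f z ∧ f y ≤ polH z y a b) :
    ∃ xstar ∈ Set.Ioc (0 : ℝ) 1,
      f xstar = (2 * a / b + 1) * xstar ∧
      IsTwoAgentEquilibrium a b f xstar (-xstar) ∧
      -xstar < 0 ∧ 0 < xstar := by
  obtain ⟨hcont, hodd, -, -, hbound⟩ := hf
  obtain ⟨z, ⟨hz0, hz1⟩, y, ⟨hy1, hy0⟩, hG, hH⟩ := hexists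
  have hc : 0 < a / b := div_pos ha hb
  have hslope : 2 * a / b + 1 = 2 * (a / b) + 1 := by ring
  have hG' : a / b * (z - y) + z ≤ f z := by
    rwa [polG, mul_div_right_comm] at hG
  have hH' : a / b * (z - y) + -y ≤ f (-y) := by
    rw [polH, mul_div_right_comm] at hH
    rw [hodd]
    linarith
  have habove : ∃ m ∈ Set.Ioc (0 : ℝ) 1, (2 * a / b + 1) * m ≤ f m := by
    rw [hslope]
    rcases le_total z (-y) with h | h
    · exact ⟨z, ⟨hz0, hz1⟩, by nlinarith⟩
    · exact ⟨-y, ⟨by linarith, by linarith⟩, by nlinarith⟩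
  obtain ⟨m, hm, hfm⟩ := habove
  obtain ⟨x, hx, hfx⟩ := exists_eq_mul_of_mul_le hcont
    (abs_le.mp (hbound 1 (by norm_num))).2 (by linarith) hm hfm
  have hx0 := hx.1
  have hx1 := hx.2
  refine ⟨x, hx, hfx, ⟨⟨by linarith, hx1⟩, ⟨by linarith, by linarith⟩, ?_, ?_⟩, by linarith, hx0⟩
  · rw [hfx]
    field_simp
    ring
  · rw [hodd, hfx]
    field_simp
    ring
end

section
/- Let a > 0 and b > 0. A point (p, q) ∈ [−1, 1]² is an equilibrium of the two-agent opinion dynamics with f = sgn_ε for every ε ∈ (0, b/(2a + b)) if and only if (p, q) is one of the five points (0, 0), (1, 1), (−1, −1), (b/(2a + b), −b/(2a + b)), and (−b/(2a + b), b/(2a + b)). -/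
/-- The continuous sign function `sgn_ε`. -/
noncomputable def sgnEps (ε x : ℝ) : ℝ :=
  if x < -ε then -1 else if x ≤ ε then x / ε else 1

theorem sgnEps_of_lt {ε x : ℝ} (hε : 0 < ε) (h : ε < x) : sgnEps ε x = 1 := by
  rw [sgnEps, if_neg (by linarith), if_neg (by linarith)]

theorem sgnEps_of_lt_neg {ε x : ℝ} (h : x < -ε) : sgnEps ε x = -1 :=
  if_pos h

theorem sgnEps_zero {ε : ℝ} (hε : 0 < ε) : sgnEps ε 0 = 0 := by
  rw [sgnEps, if_neg (by linarith), if_pos hε.le, zero_div]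

/-- For every small enough `ε > 0`, the value of `sgnEps ε x` is the sign of `x`. -/
theorem exists_pos_forall_sgnEps_eq_sign (x : ℝ) :
    ∃ δ > 0, ∀ ε, 0 < ε → ε < δ → sgnEps ε x = Real.sign x := by
  rcases lt_trichotomy x 0 with hx | rfl | hx
  · refine ⟨-x, by linarith, fun ε _ h => ?_⟩
    rw [sgnEps_of_lt_neg (by linarith), Real.sign_of_neg hx]
  · exact ⟨1, one_pos, fun ε hε _ => by rw [sgnEps_zero hε, Real.sign_zero]⟩
  · exact ⟨x, hx, fun ε hε h => by rw [sgnEps_of_lt hε h, Real.sign_of_pos hx]⟩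

theorem stmt13 (a b : ℝ) (ha : 0 < a) (hb : 0 < b) (p q : ℝ)
    (hp : p ∈ Set.Icc (-1 : ℝ) 1) (hq : q ∈ Set.Icc (-1 : ℝ) 1) :
    (∀ ε ∈ Set.Ioo (0 : ℝ) (b / (2 * a + b)),
        IsTwoAgentEquilibrium a b (sgnEps ε) p q) ↔
      ((p, q) = ((0 : ℝ), (0 : ℝ)) ∨ (p, q) = ((1 : ℝ), (1 : ℝ)) ∨
        (p, q) = ((-1 : ℝ), (-1 : ℝ)) ∨
        (p, q) = (b / (2 * a + b), -(b / (2 * a + b))) ∨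
        (p, q) = (-(b / (2 * a + b)), b / (2 * a + b))) := by
  have hd : 0 < 2 * a + b := by positivity
  have hc : 0 < b / (2 * a + b) := by positivity
  have hc1 : b / (2 * a + b) < 1 := by rw [div_lt_one hd]; linarith
  have hcd : b / (2 * a + b) * (2 * a + b) = b := div_mul_cancel₀ b hd.ne'
  simp only [Prod.mk.injEq]
  constructor
  · intro h
    obtain ⟨δ, hδ, hpδ⟩ := exists_pos_forall_sgnEps_eq_sign p
    obtain ⟨η, hη, hqη⟩ := exists_pos_forall_sgnEps_eq_sign q
    obtain ⟨ε, hε, hlt⟩ := exists_between (lt_min hc (lt_min hδ hη))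
    rw [lt_min_iff, lt_min_iff] at hlt
    obtain ⟨-, -, h₁, h₂⟩ := h ε ⟨hε, hlt.1⟩
    rw [hpδ ε hε hlt.2.1] at h₁
    rw [hqη ε hε hlt.2.2] at h₂
    have hsum : Real.sign p + Real.sign q = p + q :=
      mul_left_cancel₀ hb.ne' (by linarith)
    rcases lt_trichotomy p 0 with hp0 | rfl | hp0 <;>
      rcases lt_trichotomy q 0 with hq0 | rfl | hq0 <;>
      simp only [Real.sign_of_neg, Real.sign_of_pos, Real.sign_zero, *] at h₁ h₂ hsum
    · exact Or.inr (Or.inr (Or.inl ⟨by linarith [hp.1, hq.1], by linarith [hp.1, hq.1]⟩))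
    · nlinarith
    · have hqp : q = -p := by linarith
      subst hqp
      have hpc : -p = b / (2 * a + b) := by rw [eq_div_iff hd.ne']; linarith
      exact Or.inr (Or.inr (Or.inr (Or.inr ⟨by linarith, hpc⟩)))
    · nlinarith
    · exact Or.inl ⟨rfl, rfl⟩
    · nlinarith
    · have hqp : q = -p := by linarith
      subst hqp
      have hpc : p = b / (2 * a + b) := by rw [eq_div_iff hd.ne']; linarith
      exact Or.inr (Or.inr (Or.inr (Or.inl ⟨hpc, by linarith⟩)))
    · nlinarith
    · exact Or.inr (Or.inl ⟨by linarith [hp.2, hq.2], by linarith [hp.2, hq.2]⟩)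
  · rintro h ε ⟨hε, hεc⟩
    refine ⟨hp, hq, ?_⟩
    rcases h with ⟨rfl, rfl⟩ | ⟨rfl, rfl⟩ | ⟨rfl, rfl⟩ | ⟨rfl, rfl⟩ | ⟨rfl, rfl⟩
    · simp [sgnEps_zero hε]
    · simp [sgnEps_of_lt hε (hεc.trans hc1)]
    · simp [sgnEps_of_lt_neg (neg_lt_neg (hεc.trans hc1))]
    all_goals
      rw [sgnEps_of_lt hε hεc, sgnEps_of_lt_neg (neg_lt_neg hεc)]
      constructor <;> linarith
end

section
/- Let b > 0 and 0 < a₁ < a₂, and let f : ℝ → ℝ be Lipschitz continuous and monotone nondecreasing. Let x̄_L, x̄_R, x_L, x_R : ℝ → ℝ be differentiable functions satisfying, for all t ≥ 0: x̄_L'(t) = a₂·(x̄_R(t) − x̄_L(t)) + b·(f(x̄_L(t)) − x̄_L(t)); x_L'(t) = a₁·(x_R(t) − x_L(t)) + b·(f(x_L(t)) − x_L(t)); x̄_R'(t) = a₁·(x̄_L(t) − x̄_R(t)) + b·(f(x̄_R(t)) − x̄_R(t)); and x_R'(t) = a₂·(x_L(t) − x_R(t)) + b·(f(x_R(t)) −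 x_R(t)). Assume x_L(0) ≤ x̄_L(0), x_R(0) ≤ x̄_R(0), and x̄_L(t) < x_R(t) for all t ≥ 0. Then x_L(t) ≤ x̄_L(t) and x_R(t) ≤ x̄_R(t) for all t ≥ 0. -/
open Filter Topology in
/-- A function that is nonnegative at a point, with positive derivative if it vanishes there,
stays nonnegative immediately to the right of that point. -/
theorem HasDerivAt.eventually_nonneg_nhdsGT {g : ℝ → ℝ} {g' t : ℝ} (hg : HasDerivAt g g' t)
    (h0 : 0 ≤ g t) (hpos : g t = 0 → 0 < g') : ∀ᶠ s in 𝓝[>] t, 0 ≤ g s := by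
  rcases h0.eq_or_lt with h | h
  · have hslope : ∀ᶠ s in 𝓝[>] t, 0 < slope g t s :=
      ((hasDerivAt_iff_tendsto_slope.mp hg).mono_left
        (nhdsWithin_mono t fun s hs => ne_of_gt hs)).eventually (lt_mem_nhds (hpos h.symm))
    filter_upwards [hslope, self_mem_nhdsWithin] with s hs hts
    rw [slope_def_field, ← h, sub_zero] at hs
    exact ((div_pos_iff_of_pos_right (sub_pos.mpr hts)).mp hs).le
  · filter_upwards [nhdsWithin_le_nhds (hg.continuousAt.eventually (lt_mem_nhds h))] with s hs
    exact hs.le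


theorem stmt18 (b a₁ a₂ : ℝ) (hb : 0 < b) (ha₁ : 0 < a₁) (ha₁₂ : a₁ < a₂)
    (f : ℝ → ℝ) (K : NNReal) (hlip : LipschitzWith K f) (hmono : Monotone f)
    (xbarL xbarR xL xR : ℝ → ℝ)
    (hbarL : ∀ t : ℝ, 0 ≤ t →
      HasDerivAt xbarL (a₂ * (xbarR t - xbarL t) + b * (f (xbarL t) - xbarL t)) t)
    (hL : ∀ t : ℝ, 0 ≤ t →
      HasDerivAt xL (a₁ * (xR t - xL t) + b * (f (xL t) - xL t)) t)
    (hbarR : ∀ t : ℝ, 0 ≤ t →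
      HasDerivAt xbarR (a₁ * (xbarL t - xbarR t) + b * (f (xbarR t) - xbarR t)) t)
    (hR : ∀ t : ℝ, 0 ≤ t →
      HasDerivAt xR (a₂ * (xL t - xR t) + b * (f (xR t) - xR t)) t)
    (hinitL : xL 0 ≤ xbarL 0) (hinitR : xR 0 ≤ xbarR 0)
    (hsep : ∀ t : ℝ, 0 ≤ t → xbarL t < xR t) :
    ∀ t : ℝ, 0 ≤ t → xL t ≤ xbarL t ∧ xR t ≤ xbarR t := by
  intro T hT
  let S : Set ℝ := {t | 0 ≤ (xbarL - xL) t ∧ 0 ≤ (xbarR - xR) t}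
  have hu := fun t ht => (hbarL t ht).sub (hL t ht)
  have hv := fun t ht => (hbarR t ht).sub (hR t ht)
  have hclosed : IsClosed (S ∩ Set.Icc 0 T) := by
    have hcu : ContinuousOn (xbarL - xL) (Set.Icc 0 T) := fun t ht =>
      (hu t ht.1).continuousAt.continuousWithinAt
    have hcv : ContinuousOn (xbarR - xR) (Set.Icc 0 T) := fun t ht =>
      (hv t ht.1).continuousAt.continuousWithinAt
    have h := (hcu.prodMk hcv).preimage_isClosed_of_isClosed isClosed_Icc
      (isClosed_Ici.prod isClosed_Ici : IsClosed (Set.Ici (0 : ℝ) ×ˢ Set.Ici (0 : ℝ)))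
    rw [Set.inter_comm]
    exact h
  have hsub : Set.Icc 0 T ⊆ S := by
    refine hclosed.Icc_subset_of_forall_mem_nhdsWithin
      ⟨sub_nonneg.mpr hinitL, sub_nonneg.mpr hinitR⟩ ?_
    rintro t ⟨⟨hut, hvt⟩, ht, -⟩
    have hs := hsep t ht
    refine ((hu t ht).eventually_nonneg_nhdsGT hut fun h => ?_).and
      ((hv t ht).eventually_nonneg_nhdsGT hvt fun h => ?_)
    · have heq : xbarL t = xL t := sub_eq_zero.mp h
      have hle : xR t ≤ xbarR t := sub_nonneg.mp hvt
      rw [heq] at hs ⊢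
      nlinarith [mul_pos (sub_pos.mpr ha₁₂) (sub_pos.mpr hs),
        mul_nonneg (ha₁.trans ha₁₂).le (sub_nonneg.mpr hle)]
    · have heq : xbarR t = xR t := sub_eq_zero.mp h
      have hle : xL t ≤ xbarL t := sub_nonneg.mp hut
      rw [heq]
      nlinarith [mul_pos (sub_pos.mpr ha₁₂) (sub_pos.mpr hs),
        mul_nonneg (ha₁.trans ha₁₂).le (sub_nonneg.mpr hle)]
  obtain ⟨h₁, h₂⟩ := hsub ⟨hT, le_rfl⟩
  exact ⟨sub_nonneg.mp h₁, sub_nonneg.mp h₂⟩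
end
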